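/- arXiv:1904.06305 — 2 statements merged into one kernel-verified Lean document; each statement's English description precedes it below -/
import Mathlib

section
/- Let d ≥ 1, δ > 0, R > 0. Then there exists a constant c₀ ≥ 1, depending only on d, δ, and R, such that for every matrix G ∈ ℝ^{d×d}, every vector b ∈ ℝ^d, and every measurable set E ⊆ B_R(0) with ℒ^d(E) ≥ δ, one has sup_{x ∈ B_R(0)} |Gx + b| ≤ (ω_d R^d)^{-1} c₀ ∫_E |Gx + b| dx, and moreover (ω_d R^d)^{-1} c₀ ∫_E |Gx + b| dx ≤ c₀ · ess sup_{x ∈ E} |Gx + b|. -/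
open MeasureTheory Metric Set

/-- Matrix-vector multiplication `x ↦ G x`, regarded as a map on Euclidean space. -/
noncomputable def matVec {d : ℕ} (G : Matrix (Fin d) (Fin d) ℝ)
    (x : EuclideanSpace ℝ (Fin d)) : EuclideanSpace ℝ (Fin d) :=
  (WithLp.equiv 2 (Fin d → ℝ)).symm (G.mulVec (WithLp.equiv 2 (Fin d → ℝ) x))

/-- The volume `ω_d` of the unit ball in `ℝ^d`. -/
noncomputable def unitBallVol (d : ℕ) : ℝ :=
  (volume (ball (0 : EuclideanSpace ℝ (Fin d)) 1)).toReal

section AffineMaps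

variable {V W : Type*} [NormedAddCommGroup V] [NormedSpace ℝ V] [NormedAddCommGroup W]
  [NormedSpace ℝ W]

theorem norm_affine_apply_le {R : ℝ} (f : (V →L[ℝ] W) × W) {x : V} (hx : x ∈ ball (0 : V) R) :
    ‖f.1 x + f.2‖ ≤ (R + 1) * ‖f‖ := by
  have hx' : ‖x‖ ≤ R := (mem_ball_zero_iff.1 hx).le
  calc ‖f.1 x + f.2‖ ≤ ‖f.1‖ * ‖x‖ + ‖f.2‖ :=
        (norm_add_le _ _).trans (by gcongr; exact f.1.le_opNorm x)
    _ ≤ ‖f‖ * R + ‖f‖ := by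
        gcongr
        · exact norm_fst_le f
        · exact norm_snd_le f
    _ = (R + 1) * ‖f‖ := by ring

variable [MeasurableSpace V] [BorelSpace V]

theorem measurableSet_sublevel_affine (f : (V →L[ℝ] W) × W) (R c : ℝ) :
    MeasurableSet {x ∈ ball (0 : V) R | ‖f.1 x + f.2‖ < c} := by
  have hcont : Continuous fun x => ‖f.1 x + f.2‖ := by fun_prop
  exact (isOpen_ball.inter (isOpen_lt hcont continuous_const)).measurableSet

variable [FiniteDimensional ℝ V]

/-- The zero set of a nonzero affine map is a null set. -/
theorem measure_zeroSet_affine (μ : Measure V) [μ.IsAddHaarMeasure] {f : (V →L[ℝ] W) × W}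
    (hf : f ≠ 0) : μ {x | f.1 x + f.2 = 0} = 0 := by
  rcases Set.eq_empty_or_nonempty {x | f.1 x + f.2 = 0} with h | ⟨x₀, hx₀⟩
  · simp [h]
  have hx₀' : f.1 x₀ + f.2 = 0 := hx₀
  have hset : {x | f.1 x + f.2 = 0} =
      (AffineSubspace.mk' x₀ (LinearMap.ker (f.1 : V →ₗ[ℝ] W)) : Set V) := by
    ext x
    have : f.1 x + f.2 = f.1 x - f.1 x₀ := by
      rw [eq_neg_of_add_eq_zero_left hx₀']; abel
    simp [this, AffineSubspace.mem_mk']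
  rw [hset]
  refine Measure.addHaar_affineSubspace μ _ fun htop => hf ?_
  have hall : ∀ x, f.1 x + f.2 = 0 := fun x => by
    have : x ∈ {x | f.1 x + f.2 = 0} := by rw [hset, htop]; trivial
    exact this
  have h2 : f.2 = 0 := by simpa using hall 0
  refine Prod.ext (ContinuousLinearMap.ext fun x => ?_) h2
  simpa [h2] using hall x

/-- On a ball, the sublevel sets of normalised affine maps are uniformly small. -/
theorem exists_measure_sublevel_affine_le [FiniteDimensional ℝ W] (μ : Measure V)
    [μ.IsAddHaarMeasure] {R : ℝ} (hR : 0 < R) {η : ENNReal} (hη : 0 < η) :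
    ∃ ε : ℝ, 0 < ε ∧ ∀ f : (V →L[ℝ] W) × W, f ≠ 0 →
      μ {x ∈ ball (0 : V) R | ‖f.1 x + f.2‖ < ε * ‖f‖} ≤ η := by
  have key : ∃ ε : ℝ, 0 < ε ∧ ∀ f ∈ sphere (0 : (V →L[ℝ] W) × W) 1,
      μ {x ∈ ball (0 : V) R | ‖f.1 x + f.2‖ < ε} ≤ η := by
    have : ProperSpace ((V →L[ℝ] W) × W) := FiniteDimensional.proper ℝ _
    refine (isCompact_sphere (0 : (V →L[ℝ] W) × W) 1).induction_on
      (p := fun S => ∃ ε : ℝ, 0 < ε ∧ ∀ f ∈ S,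
        μ {x ∈ ball (0 : V) R | ‖f.1 x + f.2‖ < ε} ≤ η) ⟨1, one_pos, by simp⟩ ?_ ?_ ?_
    · rintro S T hST ⟨ε, hε, h⟩
      exact ⟨ε, hε, fun f hf => h f (hST hf)⟩
    · rintro S T ⟨ε, hε, h⟩ ⟨ε', hε', h'⟩
      refine ⟨min ε ε', lt_min hε hε', ?_⟩
      rintro f (hf | hf)
      · refine (measure_mono ?_).trans (h f hf)
        exact fun x hx => ⟨hx.1, hx.2.trans_le (min_le_left _ _)⟩
      · refine (measure_mono ?_).trans (h' f hf)
        exact fun x hx => ⟨hx.1, hx.2.trans_le (min_le_right _ _)⟩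
    · intro f hf
      have hf0 : f ≠ 0 := ne_zero_of_mem_unit_sphere (⟨f, hf⟩ : sphere (0 : (V →L[ℝ] W) × W) 1)
      have hlim : Filter.Tendsto
          (fun n : ℕ => μ {x ∈ ball (0 : V) R | ‖f.1 x + f.2‖ < 1 / ((n : ℝ) + 1)})
          Filter.atTop (nhds (μ (⋂ n : ℕ,
            {x ∈ ball (0 : V) R | ‖f.1 x + f.2‖ < 1 / ((n : ℝ) + 1)}))) := by
        refine tendsto_measure_iInter_atTop (fun n => ?_) (fun m n hmn x hx => ⟨hx.1, ?_⟩)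
          ⟨0, ((measure_mono fun x hx => hx.1).trans_lt measure_ball_lt_top).ne⟩
        · exact (measurableSet_sublevel_affine f R _).nullMeasurableSet
        · exact hx.2.trans_le (by gcongr)
      have hzero : μ (⋂ n : ℕ,
          {x ∈ ball (0 : V) R | ‖f.1 x + f.2‖ < 1 / ((n : ℝ) + 1)}) = 0 := by
        refine measure_mono_null (fun x hx => ?_) (measure_zeroSet_affine μ hf0)
        refine norm_le_zero_iff.1 (le_of_forall_pos_le_add fun ε hε => ?_)
        obtain ⟨n, hn⟩ := exists_nat_one_div_lt hε
        simpa using ((Set.mem_iInter.1 hx n).2.trans hn).le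
      rw [hzero] at hlim
      obtain ⟨n, hn⟩ := (hlim.eventually (gt_mem_nhds hη)).exists
      have hr : (0 : ℝ) < 1 / ((n : ℝ) + 1) := by positivity
      set r : ℝ := 1 / ((n : ℝ) + 1)
      refine ⟨ball f (r / (2 * (R + 1))), mem_nhdsWithin_of_mem_nhds
        (ball_mem_nhds f (by positivity)), r / 2, by positivity, fun g hg => ?_⟩
      refine (measure_mono ?_).trans hn.le
      refine fun x hx => ⟨hx.1, ?_⟩
      have h1 := norm_affine_apply_le (f - g) hx.1
      have h2 : ‖f - g‖ < r / (2 * (R + 1)) := by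
        rw [← dist_eq_norm, dist_comm]; exact hg
      have h3 : (R + 1) * ‖f - g‖ < r / 2 := by
        rw [lt_div_iff₀ (by positivity)] at h2
        linarith
      have h4 : f.1 x + f.2 = ((f - g).1 x + (f - g).2) + (g.1 x + g.2) := by
        simp only [Prod.fst_sub, Prod.snd_sub, sub_apply]; abel
      calc ‖f.1 x + f.2‖ ≤ ‖(f - g).1 x + (f - g).2‖ + ‖g.1 x + g.2‖ := by
            rw [h4]; exact norm_add_le _ _
        _ < r := by linarith [hx.2]
  obtain ⟨ε, hε, h⟩ := key
  refine ⟨ε, hε, fun f hf => ?_⟩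
  have hpos : 0 < ‖f‖ := norm_pos_iff.2 hf
  refine (measure_mono ?_).trans (h (‖f‖⁻¹ • f) (by simp [norm_smul, hpos.ne']))
  refine fun x hx => ⟨hx.1, ?_⟩
  have : (‖f‖⁻¹ • f).1 x + (‖f‖⁻¹ • f).2 = ‖f‖⁻¹ • (f.1 x + f.2) := by simp
  rw [this, norm_smul, norm_inv, norm_norm, inv_mul_lt_iff₀ hpos, mul_comm]
  exact hx.2

theorem integrableOn_norm_affine (μ : Measure V) [μ.IsAddHaarMeasure] {R : ℝ} {E : Set V}
    (f : (V →L[ℝ] W) × W) (hE : E ⊆ ball (0 : V) R) :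
    IntegrableOn (fun x => ‖f.1 x + f.2‖) E μ :=
  ((Continuous.continuousOn (by fun_prop)).integrableOn_compact
    (isCompact_closedBall (0 : V) R)).mono_set (hE.trans ball_subset_closedBall)

/-- The norm of an affine map is controlled by its `L¹` norm on any subset of a ball whose measure
is bounded below. -/
theorem exists_norm_affine_le_setIntegral [FiniteDimensional ℝ W] (μ : Measure V)
    [μ.IsAddHaarMeasure] {δ R : ℝ} (hδ : 0 < δ) (hR : 0 < R) :
    ∃ C : ℝ, 0 < C ∧ ∀ (f : (V →L[ℝ] W) × W) (E : Set V), MeasurableSet E →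
      E ⊆ ball (0 : V) R → ENNReal.ofReal δ ≤ μ E → ‖f‖ ≤ C * ∫ x in E, ‖f.1 x + f.2‖ ∂μ := by
  obtain ⟨ε, hε, h⟩ := exists_measure_sublevel_affine_le (W := W) μ hR
    (ENNReal.ofReal_pos.2 (half_pos hδ))
  refine ⟨(ε * (δ / 2))⁻¹, by positivity, fun f E hEm hE hδE => ?_⟩
  rcases eq_or_ne f 0 with rfl | hf
  · simp
  set T : Set V := {x ∈ ball (0 : V) R | ‖f.1 x + f.2‖ < ε * ‖f‖}
  have hTm : MeasurableSet T := measurableSet_sublevel_affine f R _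
  have hfin : μ (E \ T) ≠ ⊤ :=
    ((measure_mono (sdiff_subset.trans hE)).trans_lt measure_ball_lt_top).ne
  have hvol : δ / 2 ≤ μ.real (E \ T) := by
    have h1 : ENNReal.ofReal δ ≤ μ (E \ T) + ENNReal.ofReal (δ / 2) :=
      calc ENNReal.ofReal δ ≤ μ ((E \ T) ∪ T) := by
            rw [sdiff_union_self]
            exact hδE.trans (measure_mono subset_union_left)
        _ ≤ μ (E \ T) + μ T := measure_union_le _ _
        _ ≤ _ := by gcongr; exact h f hf
    rw [← ENNReal.ofReal_toReal hfin, ← ENNReal.ofReal_add ENNReal.toReal_nonneg (by positivity),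
      ENNReal.ofReal_le_ofReal_iff (by positivity)] at h1
    rw [measureReal_def]
    linarith
  have hint := integrableOn_norm_affine μ f hE
  have hlow : ε * ‖f‖ * μ.real (E \ T) ≤ ∫ x in E \ T, ‖f.1 x + f.2‖ ∂μ :=
    setIntegral_ge_of_const_le_real (hEm.diff hTm) hfin
      (fun x hx => not_lt.1 fun hlt => hx.2 ⟨hE hx.1, hlt⟩) (hint.mono_set sdiff_subset)
  have hmono : ∫ x in E \ T, ‖f.1 x + f.2‖ ∂μ ≤ ∫ x in E, ‖f.1 x + f.2‖ ∂μ :=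
    setIntegral_mono_set hint (Filter.Eventually.of_forall fun _ => norm_nonneg _)
      sdiff_subset.eventuallyLE
  rw [inv_mul_eq_div, le_div_iff₀ (by positivity)]
  calc ‖f‖ * (ε * (δ / 2)) = ε * ‖f‖ * (δ / 2) := by ring
    _ ≤ ε * ‖f‖ * μ.real (E \ T) := by gcongr
    _ ≤ _ := hlow.trans hmono

theorem setIntegral_norm_affine_le_essSup (μ : Measure V) [μ.IsAddHaarMeasure] {R : ℝ}
    (f : (V →L[ℝ] W) × W) {E : Set V} (hEm : MeasurableSet E) (hE : E ⊆ ball (0 : V) R)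
    (h0 : μ E ≠ 0) :
    ∫ x in E, ‖f.1 x + f.2‖ ∂μ ≤
      μ.real (ball (0 : V) R) * essSup (fun x => ‖f.1 x + f.2‖) (μ.restrict E) := by
  have hfin : μ E ≠ ⊤ := ((measure_mono hE).trans_lt measure_ball_lt_top).ne
  have hbdd : Filter.IsBoundedUnder (· ≤ ·) (ae (μ.restrict E)) fun x => ‖f.1 x + f.2‖ :=
    Filter.isBoundedUnder_of_eventually_le
      (ae_restrict_of_forall_mem hEm fun x hx => norm_affine_apply_le f (hE hx))
  have hae := ae_le_essSup hbdd
  have : (ae (μ.restrict E)).NeBot := ae_restrict_neBot.2 h0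
  have hnonneg : 0 ≤ essSup (fun x => ‖f.1 x + f.2‖) (μ.restrict E) := by
    obtain ⟨x, hx⟩ := hae.exists
    exact (norm_nonneg _).trans hx
  calc ∫ x in E, ‖f.1 x + f.2‖ ∂μ
      ≤ ∫ _ in E, essSup (fun x => ‖f.1 x + f.2‖) (μ.restrict E) ∂μ :=
        integral_mono_ae (integrableOn_norm_affine μ f hE) (integrableOn_const hfin) hae
    _ = μ.real E * essSup (fun x => ‖f.1 x + f.2‖) (μ.restrict E) := by
        rw [setIntegral_const, smul_eq_mul]
    _ ≤ _ := by
        gcongr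
        exact measure_ball_lt_top.ne

end AffineMaps

theorem matVec_eq_toEuclideanCLM {d : ℕ} (G : Matrix (Fin d) (Fin d) ℝ)
    (x : EuclideanSpace ℝ (Fin d)) : matVec G x = Matrix.toEuclideanCLM (𝕜 := ℝ) G x := rfl

theorem volume_real_ball_eq_unitBallVol_mul (d : ℕ) {R : ℝ} (hR : 0 < R) :
    volume.real (ball (0 : EuclideanSpace ℝ (Fin d)) R) = unitBallVol d * R ^ d := by
  rw [measureReal_def, Measure.addHaar_ball_of_pos _ _ hR, ENNReal.toReal_mul,
    ENNReal.toReal_ofReal (by positivity), finrank_euclideanSpace_fin, unitBallVol, mul_comm]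

/-- Lemma 3.2 (second part): for `d ≥ 1`, `δ > 0`, `R > 0` there is a constant
`c₀ ≥ 1`, depending only on `d`, `δ`, `R`, such that for every `G ∈ ℝ^{d×d}`,
`b ∈ ℝ^d`, and every measurable `E ⊆ B_R(0)` with `ℒ^d(E) ≥ δ`, one has
`sup_{x ∈ B_R(0)} |Gx + b| ≤ (ω_d R^d)⁻¹ c₀ ∫_E |Gx + b| dx
  ≤ c₀ · ess sup_{x ∈ E} |Gx + b|`. -/
theorem rigid_motion_linfty_control
    (d : ℕ) (hd : 1 ≤ d) (δ R : ℝ) (hδ : 0 < δ) (hR : 0 < R) :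
    ∃ c₀ : ℝ, 1 ≤ c₀ ∧
      ∀ (G : Matrix (Fin d) (Fin d) ℝ) (b : EuclideanSpace ℝ (Fin d))
        (E : Set (EuclideanSpace ℝ (Fin d))),
        MeasurableSet E → E ⊆ ball (0 : EuclideanSpace ℝ (Fin d)) R →
        ENNReal.ofReal δ ≤ volume E →
        (∀ x ∈ ball (0 : EuclideanSpace ℝ (Fin d)) R,
          ‖matVec G x + b‖ ≤
            (unitBallVol d * R ^ d)⁻¹ * c₀ * ∫ x in E, ‖matVec G x + b‖) ∧
        (unitBallVol d * R ^ d)⁻¹ * c₀ * (∫ x in E, ‖matVec G x + b‖) ≤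
          c₀ * essSup (fun x => ‖matVec G x + b‖) (volume.restrict E) := by
  obtain ⟨C, hC, hnorm⟩ := exists_norm_affine_le_setIntegral (W := EuclideanSpace ℝ (Fin d))
    (volume : Measure (EuclideanSpace ℝ (Fin d))) hδ hR
  have hv : 0 < unitBallVol d * R ^ d := by
    rw [← volume_real_ball_eq_unitBallVol_mul d hR, measureReal_def]
    exact ENNReal.toReal_pos (measure_ball_pos _ _ hR).ne' measure_ball_lt_top.ne
  refine ⟨max 1 (unitBallVol d * R ^ d * ((R + 1) * C)), le_max_left _ _,
    fun G b E hEm hE hδE => ?_⟩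
  set c := max 1 (unitBallVol d * R ^ d * ((R + 1) * C))
  have hc0 : 0 ≤ c := zero_le_one.trans (le_max_left _ _)
  simp only [matVec_eq_toEuclideanCLM]
  have h1 := hnorm (Matrix.toEuclideanCLM (𝕜 := ℝ) G, b) E hEm hE hδE
  have h2 := setIntegral_norm_affine_le_essSup volume (Matrix.toEuclideanCLM (𝕜 := ℝ) G, b) hEm hE
    ((ENNReal.ofReal_pos.2 hδ).trans_le hδE).ne'
  rw [volume_real_ball_eq_unitBallVol_mul d hR] at h2
  refine ⟨fun x hx => ?_, ?_⟩
  · have hcle : (R + 1) * C ≤ (unitBallVol d * R ^ d)⁻¹ * c := by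
      rw [inv_mul_eq_div, le_div_iff₀ hv, mul_comm]
      exact le_max_right _ _
    calc _ ≤ (R + 1) * ‖(Matrix.toEuclideanCLM (𝕜 := ℝ) G, b)‖ :=
          norm_affine_apply_le (Matrix.toEuclideanCLM (𝕜 := ℝ) G, b) hx
      _ ≤ (R + 1) * (C * ∫ x in E, ‖Matrix.toEuclideanCLM (𝕜 := ℝ) G x + b‖) := by gcongr
      _ = (R + 1) * C * ∫ x in E, ‖Matrix.toEuclideanCLM (𝕜 := ℝ) G x + b‖ := by ring
      _ ≤ _ := mul_le_mul_of_nonneg_right hcle (integral_nonneg fun _ => norm_nonneg _)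
  · rw [mul_comm _ c, mul_assoc]
    refine mul_le_mul_of_nonneg_left ?_ hc0
    rwa [inv_mul_le_iff₀ hv]
end

section
/- Let d ≥ 1, let δ > 0, R > 0, and let ψ : [0,∞) → [0,∞) be continuous, strictly increasing with ψ(0) = 0. Then there exists a continuous, strictly increasing function τ̂ : ψ([0,∞)) → [0,∞) with τ̂(0) = 0, depending only on d, δ, R, and ψ, such that for every matrix G ∈ ℝ^{d×d}, every vector b ∈ ℝ^d, and every bounded measurable set E ⊆ ℝ^d with diam(E) ≤ 2R and ℒ^d(E) ≥ δ, one has |G| ≤ τ̂( ⨍_E ψ(|Gx + b|) dx ). -/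
open MeasureTheory Metric Set

/-- The Frobenius norm of a real `d × d` matrix. -/
noncomputable def frobNorm {d : ℕ} (A : Matrix (Fin d) (Fin d) ℝ) : ℝ :=
  Real.sqrt (∑ i, ∑ j, (A i j) ^ 2)

/-- A strictly increasing continuous function on `[0,∞)` has a continuous, strictly increasing
left inverse on its range. -/
theorem StrictMonoOn.exists_continuousOn_leftInverse_Ici {f : ℝ → ℝ}
    (hc : ContinuousOn f (Ici 0)) (hm : StrictMonoOn f (Ici 0)) :
    ∃ τ : ℝ → ℝ, ContinuousOn τ (f '' Ici 0) ∧ StrictMonoOn τ (f '' Ici 0) ∧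
      ∀ x ∈ Ici (0 : ℝ), τ (f x) = x := by
  have hinv : LeftInvOn (Function.invFunOn f (Ici 0)) f (Ici 0) := hm.injOn.leftInvOn_invFunOn
  refine ⟨Function.invFunOn f (Ici 0), ?_, ?_, fun x hx => hinv hx⟩
  · have : (f '' Ici 0).OrdConnected :=
      ((isPreconnected_Ici (a := (0 : ℝ))).image f hc).ordConnected
    have : OrderTopology (f '' Ici (0 : ℝ)) := orderTopology_of_ordConnected
    have : OrderTopology (Ici (0 : ℝ)) := orderTopology_of_ordConnected
    rw [continuousOn_iff_continuous_domRestrict]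
    have hsymm := (hm.orderIso f (Ici 0)).symm.continuous
    refine (continuous_subtype_val.comp hsymm).congr fun y => ?_
    obtain ⟨x, rfl⟩ := (hm.orderIso f (Ici 0)).surjective y
    simp only [Function.comp_apply, OrderIso.symm_apply_apply, domRestrict_apply]
    exact (hinv x.2).symm
  · rintro _ ⟨x, hx, rfl⟩ _ ⟨y, hy, rfl⟩ hxy
    rw [hinv hx, hinv hy]
    exact (hm.lt_iff_lt hx hy).1 hxy

/-- The part of a cube of side `2 r` lying in a slab of half-width `w` transversal to the `j`-th
coordinate direction has volume at most `2 w (2 r) ^ (d - 1) / |v j|`. -/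
theorem volume_slab_inter_cube_le {d : ℕ} (v : Fin d → ℝ) (j : Fin d) (hv : v j ≠ 0)
    (β w r : ℝ) (x₀ : Fin d → ℝ) (hr : 0 ≤ r) :
    volume {x : Fin d → ℝ | |v ⬝ᵥ x + β| ≤ w ∧ ∀ k, |x k - x₀ k| ≤ r} ≤
      ENNReal.ofReal (2 * w * (2 * r) ^ (d - 1) / |v j|) := by
  set M : Matrix (Fin d) (Fin d) ℝ := (1 : Matrix (Fin d) (Fin d) ℝ).updateRow j v with hM
  have hdet : M.det = v j := by
    have h := Matrix.cramer_apply (1 : Matrix (Fin d) (Fin d) ℝ) v j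
    rw [Matrix.cramer_one, ← Matrix.transpose_one, Matrix.updateCol_transpose,
      Matrix.det_transpose] at h
    exact h.symm
  set S : Fin d → Set ℝ :=
    fun k => if k = j then Icc (-w - β) (w - β) else Icc (x₀ k - r) (x₀ k + r) with hS
  have hsub : {x : Fin d → ℝ | |v ⬝ᵥ x + β| ≤ w ∧ ∀ k, |x k - x₀ k| ≤ r} ⊆
      Matrix.toLin' M ⁻¹' univ.pi S := by
    rintro x ⟨hx, hxk⟩ k -
    rw [Matrix.toLin'_apply]
    by_cases hk : k = j
    · subst hk
      have : M.mulVec x k = v ⬝ᵥ x := by simp [hM, Matrix.mulVec]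
      rw [this]
      simp only [hS, if_true, mem_Icc]
      rw [abs_le] at hx
      constructor <;> linarith
    · have : M.mulVec x k = x k := by
        have h1 : M.mulVec x k = (1 : Matrix (Fin d) (Fin d) ℝ).mulVec x k := by
          simp [hM, Matrix.mulVec, Matrix.updateRow_ne hk]
        rw [h1, Matrix.one_mulVec]
      rw [this]
      simp only [hS, if_neg hk, mem_Icc]
      have := abs_le.1 (hxk k)
      constructor <;> linarith
  have hprod : volume (univ.pi S) = ENNReal.ofReal (2 * w * (2 * r) ^ (d - 1)) := by
    rw [volume_pi_pi, ← Finset.mul_prod_erase Finset.univ _ (Finset.mem_univ j),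
      Finset.prod_congr rfl (g := fun _ => ENNReal.ofReal (2 * r))]
    · rw [Finset.prod_const, Finset.card_erase_of_mem (Finset.mem_univ j), Finset.card_univ,
        Fintype.card_fin, ENNReal.ofReal_mul' (q := (2 * r) ^ (d - 1)) (by positivity),
        ENNReal.ofReal_pow (p := 2 * r) (by positivity)]
      simp only [hS, if_true, Real.volume_Icc]
      congr 2
      ring
    · intro k hk
      simp only [hS, if_neg (Finset.ne_of_mem_erase hk), Real.volume_Icc]
      congr 1
      ring
  have hdet' : LinearMap.det (Matrix.toLin' M) = v j := by rw [LinearMap.det_toLin', hdet]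
  refine (measure_mono hsub).trans ?_
  rw [Measure.addHaar_preimage_linearMap _ (by rwa [hdet']), hdet', hprod,
    ← ENNReal.ofReal_mul (abs_nonneg _), abs_inv]
  exact le_of_eq (by congr 1; ring)

theorem frobNorm_nonneg {d : ℕ} (A : Matrix (Fin d) (Fin d) ℝ) : 0 ≤ frobNorm A :=
  Real.sqrt_nonneg _

theorem exists_frobNorm_le_mul_abs {d : ℕ} (hd : 1 ≤ d) (A : Matrix (Fin d) (Fin d) ℝ) :
    ∃ i j, frobNorm A ≤ d * |A i j| := by
  have : Nonempty (Fin d) := ⟨⟨0, hd⟩⟩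
  obtain ⟨⟨i, j⟩, hij⟩ := Finite.exists_max fun p : Fin d × Fin d => |A p.1 p.2|
  refine ⟨i, j, Real.sqrt_le_iff.2 ⟨by positivity, ?_⟩⟩
  calc ∑ k, ∑ l, (A k l) ^ 2 ≤ ∑ _k : Fin d, ∑ _l : Fin d, |A i j| ^ 2 := by
        refine Finset.sum_le_sum fun k _ => Finset.sum_le_sum fun l _ => ?_
        rw [← sq_abs]
        exact pow_le_pow_left₀ (abs_nonneg _) (hij (k, l)) 2
    _ = (d * |A i j|) ^ 2 := by
      rw [mul_pow]
      simp
      ring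

/-- The sublevel sets of `x ↦ |G x + b|` on a set of diameter at most `r` have volume
`O(t / |G|)`. -/
theorem volume_inter_norm_le {d : ℕ} (hd : 1 ≤ d) (G : Matrix (Fin d) (Fin d) ℝ)
    (hG : 0 < frobNorm G) (b : EuclideanSpace ℝ (Fin d)) {E : Set (EuclideanSpace ℝ (Fin d))}
    {r t : ℝ} (hE : Bornology.IsBounded E) (hdiam : Metric.diam E ≤ r) (ht : 0 ≤ t) :
    volume (E ∩ {x | ‖matVec G x + b‖ ≤ t}) ≤
      ENNReal.ofReal (2 * t * (2 * r) ^ (d - 1) * d / frobNorm G) := by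
  rcases E.eq_empty_or_nonempty with rfl | ⟨x₀, hx₀⟩
  · simp
  have hr : 0 ≤ r := Metric.diam_nonneg.trans hdiam
  obtain ⟨i, j, hij⟩ := exists_frobNorm_le_mul_abs hd G
  have hd0 : (0 : ℝ) < d := by exact_mod_cast hd
  have hpos : 0 < |G i j| := pos_of_mul_pos_right (hG.trans_le hij) hd0.le
  set T : Set (Fin d → ℝ) := {x | |G i ⬝ᵥ x + b i| ≤ t ∧ ∀ k, |x k - x₀ k| ≤ r}
  have hsub : E ∩ {x | ‖matVec G x + b‖ ≤ t} ⊆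
      (MeasurableEquiv.toLp 2 (Fin d → ℝ)).symm ⁻¹' T := by
    rintro x ⟨hxE, hx⟩
    refine ⟨(PiLp.norm_apply_le (matVec G x + b) i).trans hx, fun k => ?_⟩
    have h1 := PiLp.norm_apply_le (x - x₀) k
    rw [← dist_eq_norm] at h1
    exact h1.trans ((Metric.dist_le_diam_of_mem hE hxE hx₀).trans hdiam)
  refine (measure_mono hsub).trans ?_
  rw [(EuclideanSpace.volume_preserving_symm_measurableEquiv_toLp (Fin d)).measure_preimage_equiv]
  refine (volume_slab_inter_cube_le (G i) j (abs_pos.1 hpos) (b i) t r x₀.ofLp hr).trans ?_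
  refine ENNReal.ofReal_le_ofReal ?_
  rw [div_le_div_iff₀ hpos hG, mul_assoc _ (d : ℝ)]
  exact mul_le_mul_of_nonneg_left hij (by positivity)

/-- If `g ≥ 0` satisfies `μ {g ≤ t} ≤ t / a`, then `g` stochastically dominates `a` times a
uniform variable on `[0,1]`. -/
theorem integral_comp_mul_le_integral_comp {Ω : Type*} [MeasurableSpace Ω] {μ : Measure Ω}
    [IsProbabilityMeasure μ] {φ : ℝ → ℝ} (hc : Continuous φ) (hm : Monotone φ)
    (hs : StrictMonoOn φ (Ici 0)) (h0 : φ 0 = 0) {g : Ω → ℝ} (hg : Measurable g)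
    (hgnn : ∀ ω, 0 ≤ g ω) (hint : Integrable (fun ω => φ (g ω)) μ) {a : ℝ} (ha : 0 < a)
    (h : ∀ t, 0 ≤ t → μ {ω | g ω ≤ t} ≤ ENNReal.ofReal (t / a)) :
    ∫ s in (0 : ℝ)..1, φ (a * s) ≤ ∫ ω, φ (g ω) ∂μ := by
  have hφnn : ∀ t, 0 ≤ t → 0 ≤ φ t := fun t ht => h0 ▸ hm ht
  have hca : Continuous fun s : ℝ => φ (a * s) := by fun_prop
  have hnn1 : 0 ≤ᵐ[volume.restrict (Ioc (0 : ℝ) 1)] fun s => φ (a * s) := by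
    filter_upwards [ae_restrict_mem measurableSet_Ioc] with s hs
    exact hφnn _ (mul_nonneg ha.le hs.1.le)
  have hnn2 : 0 ≤ᵐ[μ] fun ω => φ (g ω) := ae_of_all _ fun ω => hφnn _ (hgnn ω)
  have hint1 : Integrable (fun s => φ (a * s)) (volume.restrict (Ioc (0 : ℝ) 1)) :=
    (hca.integrableOn_Icc (a := 0) (b := 1)).mono_set Ioc_subset_Icc_self
  rw [intervalIntegral.integral_of_le zero_le_one,
    ← ENNReal.ofReal_le_ofReal_iff (integral_nonneg_of_ae hnn2),
    ofReal_integral_eq_lintegral_ofReal hint1 hnn1, ofReal_integral_eq_lintegral_ofReal hint hnn2,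
    lintegral_eq_lintegral_meas_lt _ hnn1 hca.aemeasurable,
    lintegral_eq_lintegral_meas_lt _ hnn2 (hc.measurable.comp hg).aemeasurable]
  refine setLIntegral_mono' measurableSet_Ioi fun t ht => ?_
  by_cases hu : ∃ u, 0 ≤ u ∧ φ u = t
  · obtain ⟨u, hu, rfl⟩ := hu
    have hL : volume.restrict (Ioc (0 : ℝ) 1) {s | φ u < φ (a * s)} ≤
        ENNReal.ofReal (1 - u / a) := by
      rw [Measure.restrict_apply (measurableSet_lt measurable_const hca.measurable),
        ← Real.volume_Ioc]
      refine measure_mono fun s ⟨hs1, hs2⟩ => ⟨?_, hs2.2⟩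
      rw [div_lt_iff₀' ha]
      exact hm.reflect_lt hs1
    have hR : {ω | φ u < φ (g ω)} = {ω | g ω ≤ u}ᶜ := by
      ext ω
      simp only [mem_ofPred_eq, mem_compl_iff, not_le]
      exact hs.lt_iff_lt hu (hgnn ω)
    rw [hR, prob_compl_eq_one_sub (measurableSet_le hg measurable_const)]
    refine hL.trans ?_
    rw [ENNReal.ofReal_sub _ (by positivity), ENNReal.ofReal_one]
    exact tsub_le_tsub_left (h u hu) 1
  · have hlt : ∀ x, φ x ≤ t := by
      intro x
      by_contra! hx
      have hx0 : 0 ≤ x := by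
        by_contra! hx0
        have := hm hx0.le
        rw [mem_Ioi] at ht
        linarith
      obtain ⟨u, hu1, hu2⟩ := intermediate_value_Icc hx0 hc.continuousOn
        ⟨h0.trans_le (le_of_lt ht), hx.le⟩
      exact hu ⟨u, hu1.1, hu2⟩
    simp [not_lt.2 (hlt _)]

/-- The averages of `s ↦ φ (m κ s)` over `[0,1]` depend on `m ≥ 0` in a continuous, strictly
increasing way, and have the same range as `φ`. -/
theorem integral_comp_mul_unitInterval {φ : ℝ → ℝ} (hc : Continuous φ) (hm : Monotone φ)
    (hs : StrictMonoOn φ (Ici 0)) (h0 : φ 0 = 0) {κ : ℝ} (hκ : 0 < κ) :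
    Continuous (fun m : ℝ => ∫ s in (0 : ℝ)..1, φ (m * κ * s)) ∧
      StrictMonoOn (fun m : ℝ => ∫ s in (0 : ℝ)..1, φ (m * κ * s)) (Ici 0) ∧
      (fun m : ℝ => ∫ s in (0 : ℝ)..1, φ (m * κ * s)) '' Ici 0 = φ '' Ici 0 := by
  have hcm : ∀ m : ℝ, Continuous fun s : ℝ => φ (m * κ * s) := fun m => by fun_prop
  have hcA : Continuous (fun m : ℝ => ∫ s in (0 : ℝ)..1, φ (m * κ * s)) :=
    intervalIntegral.continuous_parametric_intervalIntegral_of_continuous' (μ := volume)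
      (f := fun m s => φ (m * κ * s)) (by fun_prop) 0 1
  have hA0 : ∫ s in (0 : ℝ)..1, φ (0 * κ * s) = 0 := by simp [h0]
  refine ⟨hcA, ?_, Subset.antisymm ?_ ?_⟩
  · intro x hx y hy hxy
    refine intervalIntegral.integral_lt_integral_of_continuousOn_of_le_of_exists_lt zero_lt_one
      (hcm x).continuousOn (hcm y).continuousOn (fun s hs => hm ?_) ⟨1, by simp, ?_⟩
    · have := hs.1.le
      gcongr
    · refine hs (mem_Ici.2 ?_) (mem_Ici.2 ?_) ?_
      · have := mem_Ici.1 hx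
        positivity
      · have := mem_Ici.1 hy
        positivity
      · gcongr
  · rintro _ ⟨x, hx, rfl⟩
    rw [mem_Ici] at hx
    have hxκ : 0 ≤ x * κ := by positivity
    have hle : ∫ s in (0 : ℝ)..1, φ (x * κ * s) ≤ φ (x * κ) := by
      have := intervalIntegral.integral_mono_on (μ := volume) (zero_le_one' ℝ)
        ((hcm x).intervalIntegrable 0 1) (intervalIntegrable_const (c := φ (x * κ)))
        (fun s hs => hm (mul_le_of_le_one_right hxκ hs.2))
      simpa using this
    have hge : 0 ≤ ∫ s in (0 : ℝ)..1, φ (x * κ * s) :=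
      intervalIntegral.integral_nonneg zero_le_one fun s hs =>
        h0 ▸ hm (mul_nonneg hxκ hs.1)
    obtain ⟨u, hu, hu'⟩ := intermediate_value_Icc hxκ hc.continuousOn ⟨h0.trans_le hge, hle⟩
    exact ⟨u, hu.1, hu'⟩
  · rintro _ ⟨x, hx, rfl⟩
    rw [mem_Ici] at hx
    have hx1 : φ x < φ (x + 1) := hs hx (mem_Ici.2 (by linarith)) (by linarith)
    have hφx : 0 ≤ φ x := h0 ▸ hm hx
    have hφx1 : 0 < φ (x + 1) := hφx.trans_lt hx1
    set ε : ℝ := 1 - φ x / φ (x + 1) with hε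
    have hε0 : 0 < ε := sub_pos.2 ((div_lt_one hφx1).2 hx1)
    have hε1 : ε ≤ 1 := sub_le_self _ (by positivity)
    set m : ℝ := (x + 1) / (κ * ε) with hmdef
    have hm0 : 0 ≤ m := by positivity
    have hmκ : m * κ * ε = x + 1 := by rw [hmdef]; field_simp
    have hge : φ x ≤ ∫ s in (0 : ℝ)..1, φ (m * κ * s) := by
      have h1 : 0 ≤ ∫ s in (0 : ℝ)..ε, φ (m * κ * s) :=
        intervalIntegral.integral_nonneg hε0.le fun s hs =>
          h0 ▸ hm (mul_nonneg (by positivity) hs.1)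
      have h2 : ∫ _s in ε..1, φ (x + 1) ≤ ∫ s in ε..1, φ (m * κ * s) := by
        refine intervalIntegral.integral_mono_on hε1 intervalIntegrable_const
          ((hcm m).intervalIntegrable ε 1) fun s hs => hm ?_
        rw [← hmκ]
        exact mul_le_mul_of_nonneg_left hs.1 (by positivity)
      have h3 : ∫ _s in ε..1, φ (x + 1) = φ x := by
        rw [intervalIntegral.integral_const, smul_eq_mul, hε]
        field_simp
        ring
      rw [← intervalIntegral.integral_add_adjacent_intervals ((hcm m).intervalIntegrable 0 ε)
        ((hcm m).intervalIntegrable ε 1)]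
      linarith
    obtain ⟨u, hu, hu'⟩ := intermediate_value_Icc hm0 hcA.continuousOn
      ⟨hA0.trans_le hφx, hge⟩
    exact ⟨u, hu.1, hu'⟩

theorem continuous_matVec {d : ℕ} (G : Matrix (Fin d) (Fin d) ℝ) : Continuous (matVec G) :=
  (PiLp.continuous_toLp 2 _).comp
    (continuous_const.matrix_mulVec (PiLp.continuous_ofLp 2 _))

/-- Estimate (3.3) in Lemma 3.2: for `d ≥ 1`, `δ > 0`, `R > 0`, and a
continuous, strictly increasing `ψ : [0,∞) → [0,∞)` with `ψ(0) = 0`, there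
exists a continuous, strictly increasing `τ̂ : ψ([0,∞)) → [0,∞)` with
`τ̂(0) = 0`, depending only on `d`, `δ`, `R`, `ψ`, such that for every
`G ∈ ℝ^{d×d}`, `b ∈ ℝ^d`, and every bounded measurable `E ⊆ ℝ^d` with
`diam(E) ≤ 2R` and `ℒ^d(E) ≥ δ`, one has `|G| ≤ τ̂(⨍_E ψ(|Gx + b|) dx)`. -/
theorem rigid_motion_gradient_control
    (d : ℕ) (hd : 1 ≤ d) (δ R : ℝ) (hδ : 0 < δ) (hR : 0 < R)
    (ψ : ℝ → ℝ) (hψc : ContinuousOn ψ (Ici 0))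
    (hψm : StrictMonoOn ψ (Ici 0))
    (hψ0 : ψ 0 = 0) (hψnn : ∀ t ∈ Ici (0 : ℝ), 0 ≤ ψ t) :
    ∃ τ : ℝ → ℝ,
      ContinuousOn τ (ψ '' Ici 0) ∧ StrictMonoOn τ (ψ '' Ici 0) ∧
      (∀ t ∈ ψ '' Ici 0, 0 ≤ τ t) ∧ τ 0 = 0 ∧
      ∀ (G : Matrix (Fin d) (Fin d) ℝ) (b : EuclideanSpace ℝ (Fin d))
        (E : Set (EuclideanSpace ℝ (Fin d))),
        MeasurableSet E → Bornology.IsBounded E → Metric.diam E ≤ 2 * R →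
        ENNReal.ofReal δ ≤ volume E →
        frobNorm G ≤ τ (⨍ x in E, ψ ‖matVec G x + b‖) := by
  set φ : ℝ → ℝ := fun t => ψ (max t 0) with hφ
  have hφψ : ∀ t, 0 ≤ t → φ t = ψ t := fun t ht => by simp [hφ, ht]
  have hc : Continuous φ :=
    hψc.comp_continuous (continuous_id.max continuous_const) fun t => mem_Ici.2 (le_max_right t 0)
  have hm : Monotone φ := fun s t hst =>
    hψm.monotoneOn (le_max_right s 0) (le_max_right t 0) (max_le_max_right 0 hst)
  have hs : StrictMonoOn φ (Ici 0) := hψm.congr fun t ht => (hφψ t ht).symm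
  have h0 : φ 0 = 0 := (hφψ 0 le_rfl).trans hψ0
  have himg : φ '' Ici 0 = ψ '' Ici 0 := image_congr fun t ht => hφψ t ht
  have hd0 : (0 : ℝ) < d := by exact_mod_cast hd
  set κ : ℝ := δ / (2 * (2 * (2 * R)) ^ (d - 1) * d) with hκdef
  have hκ : 0 < κ := by positivity
  obtain ⟨hcA, hmA, hA⟩ := integral_comp_mul_unitInterval hc hm hs h0 hκ
  set A : ℝ → ℝ := fun m => ∫ s in (0 : ℝ)..1, φ (m * κ * s) with hAdef
  obtain ⟨τ, hτc, hτm, hτ⟩ := hmA.exists_continuousOn_leftInverse_Ici hcA.continuousOn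
  have hAψ : A '' Ici 0 = ψ '' Ici 0 := hA.trans himg
  have hτnn : ∀ t ∈ A '' Ici 0, 0 ≤ τ t := by
    rintro _ ⟨m, hm0, rfl⟩
    rwa [hτ m hm0]
  rw [← hAψ]
  refine ⟨τ, hτc, hτm, hτnn, ?_, fun G b E hEm hEb hEd hEδ => ?_⟩
  · have hA0 : A 0 = 0 := by simp [hAdef, h0]
    simpa [hA0] using hτ 0 self_mem_Ici
  have hE0 : volume E ≠ 0 := ((ENNReal.ofReal_pos.2 hδ).trans_le hEδ).ne'
  have hEtop : volume E ≠ ⊤ := hEb.measure_lt_top.ne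
  have : IsProbabilityMeasure ((volume E)⁻¹ • volume.restrict E) :=
    ⟨by simp [ENNReal.inv_mul_cancel hE0 hEtop]⟩
  set μ : Measure (EuclideanSpace ℝ (Fin d)) := (volume E)⁻¹ • volume.restrict E with hμ
  set g : EuclideanSpace ℝ (Fin d) → ℝ := fun x => ‖matVec G x + b‖ with hgdef
  have hg : Continuous g := ((continuous_matVec G).add continuous_const).norm
  have hgnn : ∀ x, 0 ≤ g x := fun x => norm_nonneg _
  have havg : ⨍ x in E, ψ ‖matVec G x + b‖ = ∫ x, φ (g x) ∂μ := by
    rw [setAverage_eq']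
    exact integral_congr_ae (ae_of_all _ fun x => (hφψ _ (hgnn x)).symm)
  rw [havg]
  obtain ⟨K, hK⟩ := hEb.isCompact_closure.bddAbove_image hg.continuousOn
  have hgK : ∀ᵐ x ∂μ, g x ≤ K := by
    refine Measure.ae_smul_measure ?_ _
    filter_upwards [ae_restrict_mem hEm] with x hx
    exact hK (mem_image_of_mem g (subset_closure hx))
  have hφg : ∀ᵐ x ∂μ, φ (g x) ∈ Icc 0 (φ (max K 0)) := by
    filter_upwards [hgK] with x hx
    exact ⟨h0 ▸ hm (hgnn x), hm (hx.trans (le_max_left _ _))⟩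
  have hint : Integrable (fun x => φ (g x)) μ := by
    refine Integrable.of_bound (hc.comp hg).aestronglyMeasurable (φ (max K 0)) ?_
    filter_upwards [hφg] with x hx
    rw [Real.norm_of_nonneg hx.1]
    exact hx.2
  have hmem : ∫ x, φ (g x) ∂μ ∈ A '' Ici 0 := by
    have h1 := (convex_Icc 0 (φ (max K 0))).integral_mem isClosed_Icc hφg hint
    rw [hA]
    obtain ⟨u, hu, hu'⟩ := intermediate_value_Icc (le_max_right K 0) hc.continuousOn
      ⟨h0.trans_le h1.1, h1.2⟩
    exact ⟨u, hu.1, hu'⟩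
  rcases (frobNorm_nonneg G).eq_or_lt with hG | hG
  · rw [← hG]
    exact hτnn _ hmem
  rw [← hτ (frobNorm G) hG.le]
  refine hτm.monotoneOn (mem_image_of_mem A hG.le) hmem ?_
  refine integral_comp_mul_le_integral_comp hc hm hs h0 hg.measurable hgnn hint
    (mul_pos hG hκ) fun t ht => ?_
  rw [hμ, Measure.smul_apply, smul_eq_mul,
    Measure.restrict_apply (measurableSet_le hg.measurable measurable_const), inter_comm]
  calc (volume E)⁻¹ * volume (E ∩ {x | g x ≤ t})
      ≤ (ENNReal.ofReal δ)⁻¹ *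
        ENNReal.ofReal (2 * t * (2 * (2 * R)) ^ (d - 1) * d / frobNorm G) :=
        mul_le_mul' (ENNReal.inv_le_inv.2 hEδ) (volume_inter_norm_le hd G hG b hEb hEd ht)
    _ = ENNReal.ofReal (t / (frobNorm G * κ)) := by
        rw [← ENNReal.ofReal_inv_of_pos hδ, ← ENNReal.ofReal_mul (by positivity)]
        congr 1
        rw [hκdef]
        field_simp
end
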